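/- For every integer n ≥ 2 and every integer ν with 1 ≤ ν ≤ n − 1 and 2ν ≠ n, the series Σ_{l=2}^∞ [ Ψ((l−1)/(2n)) − Ψ((l+1)/(2n)) − Ψ((l−1)/n) + Ψ((l+1)/n) ]·sin(2πνl/n) converges, and C_n(ν) = (2n/π)·ln(2·sin(πν/n)) − (2/π)·[Ψ(2/n) − Ψ(1/n)] − (2/π)·csc(2πν/n)·Σ_{l=2}^∞ [ Ψ((l−1)/(2n)) − Ψ((l+1)/(2n)) − Ψ((l−1)/n) + Ψ((l+1)/n) ]·sin(2πνl/n). -/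

import Mathlib

open Real Finset

/-- `C n ν = Σ_{l=1}^{n-1} cos(2πνl/n) · csc(πl/n)`. -/
noncomputable def C (n : ℕ) (ν : ℤ) : ℝ :=
  ∑ l ∈ Finset.Icc 1 (n - 1), Real.cos (2 * π * ν * l / n) / Real.sin (π * l / n)

/-- The digamma function `Ψ = Γ'/Γ`. -/
noncomputable def digamma (x : ℝ) : ℝ := deriv Real.Gamma x / Real.Gamma x

open Filter Topology

lemma hasDerivAt_Gamma_digamma {x : ℝ} (hx : 0 < x) :
    HasDerivAt Real.Gamma (digamma x * Real.Gamma x) x := by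
  have h : DifferentiableAt ℝ Real.Gamma x :=
    Real.differentiableAt_Gamma fun m ↦ ((neg_nonpos.mpr m.cast_nonneg).trans_lt hx).ne'
  rw [digamma, div_mul_cancel₀ _ (Real.Gamma_pos_of_pos hx).ne']
  exact h.hasDerivAt

lemma digamma_add_one {x : ℝ} (hx : 0 < x) : digamma (x + 1) = digamma x + 1 / x := by
  have h1 := (hasDerivAt_Gamma_digamma (by linarith : 0 < x + 1)).comp_add_const x 1
  have h2 := (hasDerivAt_id x).mul (hasDerivAt_Gamma_digamma hx)
  have h3 : (fun y ↦ Real.Gamma (y + 1)) =ᶠ[nhds x] id * Real.Gamma := by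
    filter_upwards [eventually_ne_nhds hx.ne'] with y hy
    simpa using Real.Gamma_add_one hy
  have h4 := (h2.congr_of_eventuallyEq h3).unique h1
  rw [Real.Gamma_add_one hx.ne'] at h4
  have hG := (Real.Gamma_pos_of_pos hx).ne'
  simp only [id] at h4
  field_simp
  apply mul_right_cancel₀ hG
  linarith

lemma digamma_monotoneOn : MonotoneOn digamma (Set.Ioi 0) := by
  have hd : ∀ x ∈ Set.Ioi (0 : ℝ), HasDerivAt (Real.log ∘ Real.Gamma) (digamma x) x := by
    intro x hx
    have hG := (Real.Gamma_pos_of_pos hx).ne'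
    have h := (hasDerivAt_Gamma_digamma hx).log hG
    rwa [mul_div_cancel_right₀ _ hG] at h
  have h := Real.convexOn_log_Gamma.monotoneOn_deriv fun x hx ↦ (hd x hx).differentiableAt
  exact h.congr fun x hx ↦ (hd x hx).deriv

/-- Legendre duplication for the digamma function. -/
lemma digamma_add_digamma_add_half {x : ℝ} (hx : 0 < x) :
    digamma x + digamma (x + 1 / 2) = 2 * digamma (2 * x) - 2 * Real.log 2 := by
  have h1 := (hasDerivAt_Gamma_digamma hx).mul
    ((hasDerivAt_Gamma_digamma (by linarith : 0 < x + 1 / 2)).comp_add_const x (1 / 2))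
  have h2 : HasDerivAt (fun y : ℝ ↦ Real.Gamma (2 * y))
      (digamma (2 * x) * Real.Gamma (2 * x) * (2 * 1)) x :=
    HasDerivAt.comp x (hasDerivAt_Gamma_digamma (by linarith : 0 < 2 * x))
      ((hasDerivAt_id x).const_mul 2)
  have h3 := (((((hasDerivAt_id x).const_mul 2).const_sub 1).const_rpow
    (by norm_num : (0 : ℝ) < 2)))
  have h4 := (h2.mul h3).mul_const (√π)
  have h5 : (Real.Gamma * fun y ↦ Real.Gamma (y + 1 / 2)) =
      fun y ↦ ((fun y : ℝ ↦ Real.Gamma (2 * y)) * fun y : ℝ ↦ (2 : ℝ) ^ (1 - 2 * id y)) y * √π := by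
    funext y
    exact Real.Gamma_mul_Gamma_add_half y
  rw [h5] at h1
  have h6 := h1.unique h4
  have h7 := Real.Gamma_mul_Gamma_add_half x
  have hne : Real.Gamma x * Real.Gamma (x + 1 / 2) ≠ 0 :=
    (mul_pos (Real.Gamma_pos_of_pos hx) (Real.Gamma_pos_of_pos (by linarith))).ne'
  simp only [id] at h6
  apply mul_right_cancel₀ hne
  linear_combination h6 + (2 * digamma (2 * x) - 2 * Real.log 2) * (-h7)

lemma digamma_one_sub_sub_digamma {x : ℝ} (hx : 0 < x) (hx1 : x < 1) :
    digamma (1 - x) - digamma x = π * Real.cos (π * x) / Real.sin (π * x) := by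
  have hs : Real.sin (π * x) ≠ 0 :=
    (Real.sin_pos_of_pos_of_lt_pi (by positivity) (by nlinarith [Real.pi_pos])).ne'
  have h1 := (hasDerivAt_Gamma_digamma hx).mul
    ((hasDerivAt_Gamma_digamma (by linarith : 0 < 1 - x)).comp_const_sub 1 x)
  have h2 := (hasDerivAt_const x π).div ((Real.hasDerivAt_sin (π * x)).comp x
    ((hasDerivAt_id x).const_mul π)) hs
  have h5 : (Real.Gamma * fun y ↦ Real.Gamma (1 - y)) =
      (fun _ ↦ π) / (Real.sin ∘ fun y ↦ π * id y) := by
    funext y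
    exact Real.Gamma_mul_Gamma_one_sub y
  rw [h5] at h1
  have h6 := h1.unique h2
  have h7 := Real.Gamma_mul_Gamma_one_sub x
  have hne : Real.Gamma x * Real.Gamma (1 - x) ≠ 0 :=
    (mul_pos (Real.Gamma_pos_of_pos hx) (Real.Gamma_pos_of_pos (by linarith))).ne'
  simp only [Function.comp] at h6
  have h8 : (digamma (1 - x) - digamma x) * (Real.Gamma x * Real.Gamma (1 - x)) =
      π * Real.cos (π * x) / Real.sin (π * x) * (Real.Gamma x * Real.Gamma (1 - x)) := by
    calc _ = π * π * Real.cos (π * x) / Real.sin (π * x) ^ 2 := by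
          linear_combination -h6
      _ = _ := by rw [h7]; field_simp
  exact mul_right_cancel₀ hne h8

/-- Nielsen's beta function, `∑ (-1) ^ j / (x + j)` for `x > 0`. -/
noncomputable def nielsenBeta (x : ℝ) : ℝ := (digamma ((x + 1) / 2) - digamma (x / 2)) / 2

lemma nielsenBeta_eq {x : ℝ} (hx : 0 < x) :
    nielsenBeta x = digamma x - digamma (x / 2) - Real.log 2 := by
  have h := digamma_add_digamma_add_half (half_pos hx)
  rw [show 2 * (x / 2) = x by ring, show x / 2 + 1 / 2 = (x + 1) / 2 by ring] at h
  rw [nielsenBeta]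
  linarith

lemma nielsenBeta_one : nielsenBeta 1 = Real.log 2 := by
  have h := nielsenBeta_eq one_pos
  rw [nielsenBeta] at h ⊢
  norm_num at h ⊢
  linarith

lemma nielsenBeta_add {x : ℝ} (hx : 0 < x) : nielsenBeta x + nielsenBeta (x + 1) = 1 / x := by
  have h := digamma_add_one (half_pos hx)
  rw [nielsenBeta, nielsenBeta, show (x + 1 + 1) / 2 = x / 2 + 1 by ring, h]
  field_simp
  ring

lemma nielsenBeta_nonneg {x : ℝ} (hx : 0 < x) : 0 ≤ nielsenBeta x := by
  have h := digamma_monotoneOn (a := x / 2) (b := (x + 1) / 2) (half_pos hx)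
    (Set.mem_Ioi.2 (by linarith)) (by linarith)
  rw [nielsenBeta]
  linarith

lemma nielsenBeta_le {x : ℝ} (hx : 0 < x) : nielsenBeta x ≤ 1 / x := by
  have h := nielsenBeta_nonneg (by linarith : 0 < x + 1)
  linarith [nielsenBeta_add hx]

lemma tendsto_nielsenBeta : Tendsto nielsenBeta atTop (𝓝 0) := by
  refine tendsto_of_tendsto_of_tendsto_of_le_of_le' tendsto_const_nhds tendsto_inv_atTop_zero ?_ ?_
  · filter_upwards [eventually_gt_atTop 0] with x hx using nielsenBeta_nonneg hx
  · filter_upwards [eventually_gt_atTop 0] with x hx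
    simpa using nielsenBeta_le hx

lemma nielsenBeta_antitoneOn : AntitoneOn nielsenBeta (Set.Ioi 0) := by
  intro x hx y hy hxy
  rw [Set.mem_Ioi] at hx hy
  have hrec : ∀ z : ℝ, 0 < z → nielsenBeta z - nielsenBeta (z + 2) = 1 / (z * (z + 1)) := by
    intro z hz
    have h1 := nielsenBeta_add hz
    have h2 := nielsenBeta_add (by linarith : 0 < z + 1)
    rw [show z + 1 + 1 = z + 2 by ring] at h2
    have h3 : 1 / (z * (z + 1)) = 1 / z - 1 / (z + 1) := by
      field_simp
      ring
    rw [h3]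
    linarith
  have hanti : Antitone fun j : ℕ ↦ nielsenBeta (x + 2 * j) - nielsenBeta (y + 2 * j) := by
    refine antitone_nat_of_succ_le fun j ↦ ?_
    have hj : (0 : ℝ) ≤ j := j.cast_nonneg
    have hx' : 0 < x + 2 * j := by positivity
    have hy' : 0 < y + 2 * j := by positivity
    have h1 := hrec _ hx'
    have h2 := hrec _ hy'
    have h3 : 1 / ((y + 2 * j) * (y + 2 * j + 1)) ≤ 1 / ((x + 2 * j) * (x + 2 * j + 1)) := by
      gcongr
    push_cast
    rw [show x + 2 * ((j : ℝ) + 1) = x + 2 * j + 2 by ring,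
      show y + 2 * ((j : ℝ) + 1) = y + 2 * j + 2 by ring]
    linarith
  have hlim : ∀ z : ℝ, Tendsto (fun j : ℕ ↦ nielsenBeta (z + 2 * j)) atTop (𝓝 0) := fun z ↦
    tendsto_nielsenBeta.comp <| tendsto_atTop_add_const_left _ _ <|
      tendsto_natCast_atTop_atTop.const_mul_atTop two_pos
  have h := hanti.le_of_tendsto ((hlim x).sub (hlim y)) 0
  simp only [Nat.cast_zero, mul_zero, add_zero, sub_zero] at h
  linarith

lemma nielsenBeta_add_nielsenBeta_one_sub {x : ℝ} (hx : 0 < x) (hx1 : x < 1) :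
    nielsenBeta x + nielsenBeta (1 - x) = π / Real.sin (π * x) := by
  have h1 := digamma_one_sub_sub_digamma (half_pos hx) (by linarith)
  have h2 := digamma_one_sub_sub_digamma (by linarith : 0 < (1 - x) / 2) (by linarith)
  have hc : 0 < Real.cos (π * (x / 2)) :=
    Real.cos_pos_of_mem_Ioo ⟨by nlinarith [Real.pi_pos], by nlinarith [Real.pi_pos]⟩
  have hs : 0 < Real.sin (π * (x / 2)) :=
    Real.sin_pos_of_pos_of_lt_pi (by positivity) (by nlinarith [Real.pi_pos])
  rw [show π * ((1 - x) / 2) = π / 2 - π * (x / 2) by ring, Real.cos_pi_div_two_sub,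
    Real.sin_pi_div_two_sub, show 1 - (1 - x) / 2 = (x + 1) / 2 by ring] at h2
  rw [show π * x = 2 * (π * (x / 2)) by ring, Real.sin_two_mul, nielsenBeta, nielsenBeta,
    show (1 - x + 1) / 2 = 1 - x / 2 by ring]
  have h3 : π / (2 * Real.sin (π * (x / 2)) * Real.cos (π * (x / 2))) =
      (π * Real.cos (π * (x / 2)) / Real.sin (π * (x / 2)) +
        π * Real.sin (π * (x / 2)) / Real.cos (π * (x / 2))) / 2 := by
    generalize π * (x / 2) = φ at hc hs ⊢
    field_simp
    linarith [Real.sin_sq_add_cos_sq φ]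
  rw [h3, ← h1, ← h2]
  ring

/-- The logarithmic series converges on the unit circle away from `1`. -/
lemma tendsto_sum_pow_div_neg_log {z : ℂ} (hz : ‖z‖ = 1) (hz1 : z ≠ 1) :
    Tendsto (fun K : ℕ ↦ ∑ j ∈ Finset.range K, z ^ (j + 1) / ((j : ℂ) + 1)) atTop
      (𝓝 (-Complex.log (1 - z))) := by
  have hconv : CauchySeq fun K : ℕ ↦
      ∑ j ∈ Finset.range K, (1 / ((j : ℝ) + 1)) • z ^ (j + 1) := by
    refine Antitone.cauchySeq_series_mul_of_tendsto_zero_of_bounded (b := 2 / ‖z - 1‖) ?_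
      tendsto_one_div_add_atTop_nhds_zero_nat fun K ↦ ?_
    · intro a b hab
      have : (a : ℝ) ≤ b := by exact_mod_cast hab
      dsimp only
      gcongr
    · have h : ∑ j ∈ Finset.range K, z ^ (j + 1) = z * ((z ^ K - 1) / (z - 1)) := by
        rw [← geom_sum_eq hz1, Finset.mul_sum]
        exact Finset.sum_congr rfl fun j _ ↦ pow_succ' z j
      rw [h, norm_mul, norm_div, hz, one_mul]
      gcongr
      calc ‖z ^ K - 1‖ ≤ ‖z ^ K‖ + ‖(1 : ℂ)‖ := norm_sub_le _ _
        _ = 2 := by rw [norm_pow, hz]; norm_num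
  obtain ⟨l, hl⟩ := cauchySeq_tendsto_of_complete hconv
  have hl' : Tendsto (fun K : ℕ ↦ ∑ j ∈ Finset.range K, z ^ (j + 1) / ((j : ℂ) + 1)) atTop
      (𝓝 l) := by
    refine hl.congr fun K ↦ Finset.sum_congr rfl fun j _ ↦ ?_
    rw [Complex.real_smul]
    push_cast
    ring
  have hshift : Tendsto (fun K : ℕ ↦ ∑ j ∈ Finset.range K, z ^ j / (j : ℂ)) atTop (𝓝 l) := by
    rw [← tendsto_add_atTop_iff_nat 1]
    refine hl'.congr fun K ↦ ?_
    rw [Finset.sum_range_succ']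
    simp
  have habel := Complex.tendsto_tsum_powerSeries_nhdsWithin_lt hshift
  rw [tendsto_map'_iff] at habel
  have hre : z.re < 1 := by
    refine lt_of_le_of_ne (hz ▸ Complex.re_le_norm z) fun h ↦ hz1 ?_
    have h2 := Complex.sq_norm z
    rw [hz, Complex.normSq_apply, h] at h2
    have h3 : z.im = 0 := by nlinarith
    exact Complex.ext h h3
  have hcont : Tendsto (fun x : ℝ ↦ -Complex.log (1 - z * x)) (𝓝[<] 1)
      (𝓝 (-Complex.log (1 - z))) := by
    have hc : ContinuousAt (fun x : ℝ ↦ -Complex.log (1 - z * x)) 1 := by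
      refine (ContinuousAt.clog (by fun_prop) (Or.inl ?_)).neg
      simpa using hre
    have := hc.tendsto.mono_left (nhdsWithin_le_nhds (s := Set.Iio 1))
    simpa using this
  have heq : (fun x : ℝ ↦ -Complex.log (1 - z * x)) =ᶠ[𝓝[<] 1]
      ((fun w : ℂ ↦ ∑' j : ℕ, z ^ j / (j : ℂ) * w ^ j) ∘ Complex.ofReal) := by
    filter_upwards [Ioo_mem_nhdsLT (show (0 : ℝ) < 1 by norm_num)] with x hx
    have hn : ‖z * x‖ < 1 := by
      rw [norm_mul, hz, one_mul, Complex.norm_real, Real.norm_of_nonneg hx.1.le]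
      exact hx.2
    rw [← (Complex.hasSum_taylorSeries_neg_log hn).tsum_eq]
    refine tsum_congr fun j ↦ ?_
    rw [mul_pow]
    ring
  rw [tendsto_nhds_unique (hcont.congr' heq) habel]
  exact hl'

lemma tendsto_sum_cos_div {θ : ℝ} (h0 : 0 < θ) (h1 : θ < 2 * π) :
    Tendsto (fun K : ℕ ↦ ∑ j ∈ Finset.range K, Real.cos ((j + 1) * θ) / ((j : ℝ) + 1)) atTop
      (𝓝 (-Real.log (2 * Real.sin (θ / 2)))) := by
  have hs : 0 < Real.sin (θ / 2) := Real.sin_pos_of_pos_of_lt_pi (by linarith) (by linarith)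
  have hcos : Real.cos θ = 1 - 2 * Real.sin (θ / 2) ^ 2 := by
    have h := Real.cos_two_mul (θ / 2)
    rw [show 2 * (θ / 2) = θ by ring] at h
    linarith [Real.sin_sq_add_cos_sq (θ / 2)]
  set z : ℂ := Complex.exp (θ * Complex.I) with hzdef
  have hz : ‖z‖ = 1 := Complex.norm_exp_ofReal_mul_I θ
  have hzre : z.re = Real.cos θ := Complex.exp_ofReal_mul_I_re θ
  have hzim : z.im = Real.sin θ := Complex.exp_ofReal_mul_I_im θ
  have hz1 : z ≠ 1 := by
    intro h
    rw [h, Complex.one_re] at hzre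
    nlinarith [sq_pos_of_pos hs]
  have hnorm : ‖1 - z‖ = 2 * Real.sin (θ / 2) := by
    rw [← sq_eq_sq₀ (norm_nonneg _) (by positivity), Complex.sq_norm, Complex.normSq_apply,
      Complex.sub_re, Complex.sub_im, hzre, hzim, Complex.one_re, Complex.one_im]
    nlinarith [Real.sin_sq_add_cos_sq θ]
  have h := (Complex.continuous_re.tendsto _).comp (tendsto_sum_pow_div_neg_log hz hz1)
  rw [Complex.neg_re, Complex.log_re, hnorm] at h
  refine h.congr fun K ↦ ?_
  rw [Function.comp_apply, Complex.re_sum]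
  refine Finset.sum_congr rfl fun j _ ↦ ?_
  have hp : z ^ (j + 1) = Complex.exp (((((j : ℝ) + 1) * θ : ℝ) : ℂ) * Complex.I) := by
    rw [hzdef, ← Complex.exp_nat_mul]
    congr 1
    push_cast
    ring
  rw [hp, show ((j : ℂ) + 1) = (((j : ℝ) + 1 : ℝ) : ℂ) by push_cast; rfl, Complex.div_ofReal_re,
    Complex.exp_ofReal_mul_I_re]

lemma sum_range_sub_shift {M : Type*} [AddCommGroup M] (u : ℕ → M) (n K : ℕ) :
    ∑ j ∈ Finset.range K, (u j - u (j + n)) =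
      ∑ j ∈ Finset.range n, u j - ∑ j ∈ Finset.range n, u (j + K) := by
  have h1 := Finset.sum_range_add u n K
  have h2 := Finset.sum_range_add u K n
  rw [add_comm K n, h1] at h2
  rw [Finset.sum_sub_distrib]
  simp only [add_comm _ n, add_comm _ K]
  rw [sub_eq_sub_iff_add_eq_add]
  exact h2.symm

/-- The cosine series with coefficients `nielsenBeta (k / n)` at a multiple of `2π / n`. -/
lemma tendsto_sum_nielsenBeta_mul_cos {n ν : ℕ} (hν1 : 0 < ν) (hν2 : ν < n) {θ : ℝ}
    (hθ : θ = 2 * π * ν / n) :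
    Tendsto (fun K : ℕ ↦ ∑ j ∈ Finset.range K,
        nielsenBeta (((j : ℝ) + 1) / n) * Real.cos ((j + 1) * θ)) atTop
      (𝓝 ((∑ j ∈ Finset.range n, nielsenBeta (((j : ℝ) + 1) / n) * Real.cos ((j + 1) * θ)) / 2
        - n / 2 * Real.log (2 * Real.sin (θ / 2)))) := by
  have hn : (0 : ℝ) < n := by exact_mod_cast hν1.trans hν2
  have hν : (0 : ℝ) < ν := by exact_mod_cast hν1
  have hνn : (ν : ℝ) < n := by exact_mod_cast hν2
  have h0 : 0 < θ := by rw [hθ]; positivity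
  have h1 : θ < 2 * π := by
    rw [hθ, div_lt_iff₀ hn]
    nlinarith [Real.pi_pos]
  set u : ℕ → ℝ := fun j ↦ nielsenBeta (((j : ℝ) + 1) / n) * Real.cos ((j + 1) * θ) with hu
  have hu0 : Tendsto u atTop (𝓝 0) := by
    refine squeeze_zero_norm' (a := fun j : ℕ ↦ nielsenBeta (((j : ℝ) + 1) / n)) ?_ ?_
    · filter_upwards with j
      have hb := nielsenBeta_nonneg (x := ((j : ℝ) + 1) / n) (by positivity)
      rw [hu, norm_mul, Real.norm_of_nonneg hb]
      exact mul_le_of_le_one_right hb (Real.abs_cos_le_one _)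
    · exact tendsto_nielsenBeta.comp <| Tendsto.atTop_div_const hn <|
        tendsto_atTop_add_const_right _ _ tendsto_natCast_atTop_atTop
  have hsum : ∀ K : ℕ, ∑ j ∈ Finset.range K, u j =
      (∑ j ∈ Finset.range n, u j - ∑ j ∈ Finset.range n, u (j + K)) / 2 +
        n / 2 * ∑ j ∈ Finset.range K, Real.cos ((j + 1) * θ) / ((j : ℝ) + 1) := by
    intro K
    rw [← sum_range_sub_shift, Finset.sum_div, Finset.mul_sum, ← Finset.sum_add_distrib]
    refine Finset.sum_congr rfl fun j _ ↦ ?_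
    have hper : Real.cos (((j + n : ℕ) + 1) * θ) = Real.cos ((j + 1) * θ) := by
      rw [← Real.cos_add_nat_mul_two_pi (((j : ℝ) + 1) * θ) ν]
      congr 1
      rw [hθ]
      push_cast
      field_simp
      ring
    have hb := nielsenBeta_add (x := ((j : ℝ) + 1) / n) (by positivity)
    have hx : (((j + n : ℕ) : ℝ) + 1) / n = ((j : ℝ) + 1) / n + 1 := by
      push_cast
      field_simp
      ring
    rw [one_div_div] at hb
    simp only [hu]
    rw [hper, hx]
    have : (n : ℝ) / 2 * (Real.cos ((j + 1) * θ) / ((j : ℝ) + 1)) =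
        (n / ((j : ℝ) + 1)) * Real.cos ((j + 1) * θ) / 2 := by ring
    rw [this, ← hb]
    ring
  have hshift : Tendsto (fun K ↦ ∑ j ∈ Finset.range n, u (j + K)) atTop (𝓝 0) := by
    have := tendsto_finsetSum (Finset.range n) fun j _ ↦
      hu0.comp (tendsto_add_atTop_nat j)
    simpa [Function.comp_def, add_comm] using this
  have hlim := ((hshift.const_sub (∑ j ∈ Finset.range n, u j)).div_const 2).add
    ((tendsto_sum_cos_div h0 h1).const_mul ((n : ℝ) / 2))
  rw [sub_zero, mul_neg, ← sub_eq_add_neg] at hlim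
  exact hlim.congr fun K ↦ (hsum K).symm

/-- Summation by parts for a sine sum with coefficients `b (k + 1) - b (k - 1)`. -/
lemma sum_sub_mul_sin (b : ℕ → ℝ) (θ : ℝ) (K : ℕ) :
    ∑ m ∈ Finset.range K, (b (m + 3) - b (m + 1)) * Real.sin ((m + 2) * θ) =
      -2 * Real.sin θ * ∑ j ∈ Finset.range K, b (j + 1) * Real.cos ((j + 1) * θ)
        - b 2 * Real.sin θ + b (K + 1) * Real.sin (K * θ)
        + b (K + 2) * Real.sin ((K + 1) * θ) := by
  induction K with
  | zero => simp
  | succ K ih =>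
    rw [Finset.sum_range_succ, Finset.sum_range_succ, ih]
    push_cast
    have h1 : Real.sin (((K : ℝ) + 2) * θ) = Real.sin ((K + 1) * θ) * Real.cos θ +
        Real.cos ((K + 1) * θ) * Real.sin θ := by
      rw [← Real.sin_add]; congr 1; ring
    have h2 : Real.sin ((K : ℝ) * θ) = Real.sin ((K + 1) * θ) * Real.cos θ -
        Real.cos ((K + 1) * θ) * Real.sin θ := by
      rw [← Real.sin_sub]; congr 1; ring
    rw [show (K : ℝ) + 1 + 1 = K + 2 by ring, h1, h2]
    ring

/-- The cosecant sum in terms of Nielsen's beta function. -/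
lemma C_eq_sum_nielsenBeta {n : ℕ} (hn : 0 < n) (ν : ℕ) {θ : ℝ} (hθ : θ = 2 * π * ν / n) :
    C n ν = 2 / π * (∑ j ∈ Finset.range n,
      nielsenBeta (((j : ℝ) + 1) / n) * Real.cos ((j + 1) * θ) - Real.log 2) := by
  obtain ⟨N, rfl⟩ : ∃ N, n = N + 1 := ⟨n - 1, by omega⟩
  have hn' : ((N + 1 : ℕ) : ℝ) ≠ 0 := by positivity
  have hlast : nielsenBeta (((N : ℝ) + 1) / (N + 1 : ℕ)) * Real.cos ((N + 1) * θ) =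
      Real.log 2 := by
    rw [show ((N : ℝ) + 1) / (N + 1 : ℕ) = 1 by push_cast; field_simp, nielsenBeta_one,
      show ((N : ℝ) + 1) * θ = ν * (2 * π) by rw [hθ]; push_cast; field_simp,
      Real.cos_nat_mul_two_pi, mul_one]
  rw [Finset.sum_range_succ, hlast, add_sub_cancel_right]
  set f : ℕ → ℝ := fun j ↦
    nielsenBeta (((j : ℝ) + 1) / (N + 1 : ℕ)) * Real.cos ((j + 1) * θ) with hf
  have hC : C (N + 1) ν = ∑ j ∈ Finset.range N,
      Real.cos ((j + 1) * θ) / Real.sin (π * (((j : ℝ) + 1) / (N + 1 : ℕ))) := by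
    have hIcc : Finset.Icc 1 N = Finset.Ico (0 + 1) (N + 1) := by
      ext
      simp only [Finset.mem_Icc, Finset.mem_Ico]
      omega
    rw [C, Nat.add_sub_cancel, hIcc, ← Finset.sum_Ico_add' _ 0 N 1, ← Finset.range_eq_Ico]
    refine Finset.sum_congr rfl fun j _ ↦ ?_
    rw [hθ]
    push_cast
    congr 2 <;> ring
  have hrefl := Finset.sum_range_reflect f N
  have hpair : ∑ j ∈ Finset.range N, (f j + f (N - 1 - j)) = π * C (N + 1) ν := by
    rw [hC, Finset.mul_sum]
    refine Finset.sum_congr rfl fun j hj ↦ ?_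
    have hjN : j + 1 ≤ N := Finset.mem_range.1 hj
    have hjN' : (j : ℝ) + 1 ≤ N := by exact_mod_cast hjN
    have hcast : ((N - 1 - j : ℕ) : ℝ) + 1 = (N + 1 : ℕ) - ((j : ℝ) + 1) := by
      have : N - 1 - j + 1 + (j + 1) = N + 1 := by omega
      rw [eq_sub_iff_add_eq]
      exact_mod_cast this
    have hcos : Real.cos (((N + 1 : ℕ) - ((j : ℝ) + 1)) * θ) = Real.cos ((j + 1) * θ) := by
      rw [← Real.cos_nat_mul_two_pi_sub (((j : ℝ) + 1) * θ) ν]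
      congr 1
      rw [hθ]
      field_simp
    have hb := nielsenBeta_add_nielsenBeta_one_sub (x := ((j : ℝ) + 1) / (N + 1 : ℕ))
      (by positivity) (by rw [div_lt_one (by positivity)]; push_cast; linarith)
    simp only [hf]
    rw [hcast, hcos, sub_div, div_self hn', ← add_mul, hb]
    ring
  rw [Finset.sum_add_distrib, hrefl] at hpair
  have hpi := Real.pi_ne_zero
  field_simp
  linarith

theorem C_series_rep (n : ℕ) (hn : 2 ≤ n) (ν : ℕ) (hν1 : 1 ≤ ν) (hν2 : ν ≤ n - 1)
    (hν3 : 2 * ν ≠ n) :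
    Summable (fun m : ℕ =>
      (digamma (((m : ℝ) + 2 - 1) / (2 * n)) - digamma (((m : ℝ) + 2 + 1) / (2 * n))
          - digamma (((m : ℝ) + 2 - 1) / n) + digamma (((m : ℝ) + 2 + 1) / n))
        * Real.sin (2 * π * ν * ((m : ℝ) + 2) / n)) ∧
    C n (ν : ℤ)
      = (2 * n / π) * Real.log (2 * Real.sin (π * ν / n))
        - (2 / π) * (digamma (2 / n) - digamma (1 / n))
        - (2 / π) * (1 / Real.sin (2 * π * ν / n)) *
            ∑' m : ℕ,
              (digamma (((m : ℝ) + 2 - 1) / (2 * n)) - digamma (((m : ℝ) + 2 + 1) / (2 * n))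
                  - digamma (((m : ℝ) + 2 - 1) / n) + digamma (((m : ℝ) + 2 + 1) / n))
                * Real.sin (2 * π * ν * ((m : ℝ) + 2) / n) := by
  have hnpos : (0 : ℝ) < n := by exact_mod_cast (by omega : 0 < n)
  obtain ⟨θ, hθ⟩ : ∃ θ : ℝ, θ = 2 * π * ν / n := ⟨_, rfl⟩
  set b : ℕ → ℝ := fun k ↦ nielsenBeta ((k : ℝ) / n) with hb
  have hdig : ∀ k : ℕ, 0 < k →
      digamma ((k : ℝ) / n) = digamma ((k : ℝ) / (2 * n)) + b k + Real.log 2 := by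
    intro k hk
    have h := nielsenBeta_eq (x := (k : ℝ) / n) (by positivity)
    rw [div_div, mul_comm (n : ℝ) 2] at h
    simp only [hb]
    linarith
  have hterm : ∀ m : ℕ,
      (digamma (((m : ℝ) + 2 - 1) / (2 * n)) - digamma (((m : ℝ) + 2 + 1) / (2 * n))
          - digamma (((m : ℝ) + 2 - 1) / n) + digamma (((m : ℝ) + 2 + 1) / n))
        * Real.sin (2 * π * ν * ((m : ℝ) + 2) / n) =
      (b (m + 3) - b (m + 1)) * Real.sin ((m + 2) * θ) := by
    intro m
    have h1 := hdig (m + 1) (by omega)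
    have h3 := hdig (m + 3) (by omega)
    push_cast at h1 h3
    rw [show (m : ℝ) + 2 - 1 = m + 1 by ring, show (m : ℝ) + 2 + 1 = m + 3 by ring, h1, h3,
      show 2 * π * ν * ((m : ℝ) + 2) / n = (m + 2) * θ by rw [hθ]; ring]
    ring
  have hb0 : Tendsto b atTop (𝓝 0) :=
    tendsto_nielsenBeta.comp (tendsto_natCast_atTop_atTop.atTop_div_const hnpos)
  have hbnonneg : ∀ k, 0 < k → 0 ≤ b k := fun k hk ↦ nielsenBeta_nonneg (by positivity)
  have hbanti : ∀ m, b (m + 3) ≤ b (m + 1) := by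
    intro m
    refine nielsenBeta_antitoneOn (Set.mem_Ioi.2 (by positivity)) (Set.mem_Ioi.2 (by positivity)) ?_
    push_cast
    gcongr
    norm_num
  have hsummable : Summable fun m : ℕ ↦ (b (m + 3) - b (m + 1)) * Real.sin ((m + 2) * θ) := by
    have hdiff : Summable fun m : ℕ ↦ b (m + 1) - b (m + 3) := by
      refine summable_of_sum_range_le (c := b 1 + b 2) (fun m ↦ sub_nonneg.2 (hbanti m)) fun K ↦ ?_
      have h := sum_range_sub_shift (fun m ↦ b (m + 1)) 2 K
      simp only [Finset.sum_range_succ, Finset.sum_range_zero, zero_add] at h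
      calc ∑ m ∈ Finset.range K, (b (m + 1) - b (m + 3)) = _ := h
        _ ≤ b 1 + b 2 := by
          have h1 := hbnonneg (K + 1) (by omega)
          have h2 := hbnonneg (1 + K + 1) (by omega)
          norm_num
          linarith
    refine Summable.of_norm_bounded hdiff fun m ↦ ?_
    rw [norm_mul, norm_sub_rev, Real.norm_of_nonneg (sub_nonneg.2 (hbanti m))]
    exact mul_le_of_le_one_right (sub_nonneg.2 (hbanti m)) (Real.abs_sin_le_one _)
  have hsinθ : Real.sin θ ≠ 0 := by
    rw [Ne, Real.sin_eq_zero_iff]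
    rintro ⟨k, hk⟩
    rw [hθ, eq_div_iff hnpos.ne'] at hk
    have h1 : (k : ℝ) * n = 2 * ν := mul_left_cancel₀ Real.pi_ne_zero (by linarith)
    have h2 : k * n = 2 * ν := by exact_mod_cast h1
    have hk0 : 0 < k := by
      by_contra! hk0
      nlinarith
    have hk2 : k < 2 := by
      by_contra! hk2
      have : (ν : ℤ) < n := by omega
      nlinarith
    have hk1 : k = 1 := by omega
    subst hk1
    omega
  have hbdry : ∀ (i : ℕ) (s : ℕ → ℝ), Tendsto (fun K ↦ b (K + i) * Real.sin (s K)) atTop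
      (𝓝 0) := by
    intro i s
    refine (hb0.comp (tendsto_add_atTop_nat i)).zero_mul_isBoundedUnder_le ?_
    exact isBoundedUnder_of ⟨1, fun K ↦ Real.abs_sin_le_one _⟩
  have hA := tendsto_sum_nielsenBeta_mul_cos (by omega : 0 < ν) (by omega : ν < n) hθ
  have hlim := ((((hA.const_mul (-2 * Real.sin θ)).sub_const (b 2 * Real.sin θ)).add
    (hbdry 1 fun K ↦ K * θ)).add (hbdry 2 fun K ↦ (K + 1) * θ))
  have htsum := tendsto_nhds_unique hsummable.hasSum.tendsto_sum_nat
    (hlim.congr fun K ↦ by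
      rw [sum_sub_mul_sin]
      simp only [hb]
      push_cast
      rfl)
  have hC := C_eq_sum_nielsenBeta (by omega : 0 < n) ν hθ
  have h2 := hdig 2 (by omega)
  rw [Nat.cast_ofNat, mul_comm (2 : ℝ) (n : ℝ), div_mul_eq_div_div_swap, div_self two_ne_zero] at h2
  simp only [hterm]
  refine ⟨hsummable, ?_⟩
  rw [htsum, hC, ← hθ, h2, show π * ν / n = θ / 2 by rw [hθ]; ring]
  have hpi := Real.pi_ne_zero
  generalize ∑ j ∈ Finset.range n, nielsenBeta (((j : ℝ) + 1) / n) * Real.cos ((j + 1) * θ) = A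
  field_simp
  ring
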